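/- arXiv:1202.1185 — 5 statements merged into one kernel-verified Lean document; each statement's English description precedes it below -/
import Mathlib

section
/- Let K be a field of characteristic different from 2 whose absolute Galois group Gal(K^sep/K) is topologically finitely generated. Let g be a natural number and let a_1, …, a_{2g+2} be pairwise distinct elements of K. Then there exist a finite subset C ⊆ K and a finite set L ⊆ K × (K \ {0}) such that for every c ∈ K \ C there exist a pair (r, s) ∈ L and an element y ∈ K with y^2 = ∏_{j=1}^{2g+2} ((c − r)/s − a_j). -/
theorem aux_weights (K : Type*) [Field K] [Infinite K] (ι : Type*) [Fintype ι] :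
    ∃ w : ι → K, ∀ I : Finset ι, I.Nonempty → ∑ i ∈ I, w i ≠ 0 := by
  classical
  let P : MvPolynomial ι K := ∏ I ∈ (Finset.univ : Finset (Finset ι)).filter (fun I => I.Nonempty),
    ∑ i ∈ I, MvPolynomial.X i
  have hP : P ≠ 0 := by
    refine Finset.prod_ne_zero_iff.2 fun I hI h0 => ?_
    obtain ⟨i, hi⟩ := (Finset.mem_filter.1 hI).2
    have := congrArg (MvPolynomial.eval (Pi.single i (1 : K))) h0
    simp [Pi.single_apply, hi] at this
  by_contra! hcon
  apply hP
  apply MvPolynomial.funext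
  intro w
  obtain ⟨I, hI, h0⟩ := hcon w
  simp only [P, map_prod, map_sum, MvPolynomial.eval_X, map_zero]
  exact Finset.prod_eq_zero (i := I) (by simp [hI]) h0

theorem aux_color (K : Type*) [Field K] (hchar : ringChar K ≠ 2)
    (Ω : Type*) [Field Ω] [Algebra K Ω] [IsSepClosure K Ω]
    (S : Finset (Ω ≃ₐ[K] Ω))
    (hS : Dense ((Subgroup.closure (S : Set (Ω ≃ₐ[K] Ω)) : Subgroup (Ω ≃ₐ[K] Ω)) :
      Set (Ω ≃ₐ[K] Ω))) :
    ∃ f : K → (S → Prop), ∀ x x' : K, f x = f x' → ∃ z : K, z ^ 2 = x * x' := by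
  have : IsGalois K Ω := IsSepClosure.isGalois
  have : IsSepClosed Ω := IsSepClosure.sep_closed K
  have h2 : (2 : K) ≠ 0 := Ring.two_ne_zero hchar
  have h2' : NeZero ((2 : ℕ) : Ω) := ⟨by
    have := (map_ne_zero (algebraMap K Ω)).2 h2
    rw [map_ofNat] at this
    exact_mod_cast this⟩
  choose q hq using fun x : K => IsSepClosed.exists_pow_nat_eq (algebraMap K Ω x) 2
  refine ⟨fun x σ => σ.1 (q x) = q x, fun x x' h => ?_⟩
  have hpm : ∀ (σ : Ω ≃ₐ[K] Ω) (x : K), σ (q x) = q x ∨ σ (q x) = - q x := by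
    intro σ x
    apply sq_eq_sq_iff_eq_or_eq_neg.1
    rw [← map_pow, hq, AlgEquiv.commutes]
  have hfix : ∀ σ ∈ S, σ (q x * q x') = q x * q x' := by
    intro σ hσ
    have h1 : (σ (q x) = q x) = (σ (q x') = q x') := congrFun h ⟨σ, hσ⟩
    rw [map_mul]
    rcases hpm σ x with ha | ha
    · rw [ha, h1.mp ha]
    · rcases hpm σ x' with hb | hb
      · rw [hb, h1.mpr hb]
      · rw [ha, hb]; ring
  set F : IntermediateField K Ω := IntermediateField.adjoin K {q x * q x'} with hF
  have hle : Subgroup.closure (S : Set (Ω ≃ₐ[K] Ω)) ≤ F.fixingSubgroup := by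
    rw [Subgroup.closure_le]
    intro σ hσ
    rw [SetLike.mem_coe, hF, IntermediateField.mem_fixingSubgroup_iff]
    intro y hy
    induction hy using IntermediateField.adjoin_induction with
    | mem y hy => rw [Set.mem_singleton_iff.1 hy]; exact hfix σ hσ
    | algebraMap y => exact σ.commutes y
    | add y z _ _ hy hz => simp [hy, hz]
    | inv y _ hy => simp [hy]
    | mul y z _ _ hy hz => simp [hy, hz]
  have htop : ∀ σ : Ω ≃ₐ[K] Ω, σ ∈ F.fixingSubgroup := by
    intro σ
    have hc : IsClosed (F.fixingSubgroup : Set (Ω ≃ₐ[K] Ω)) := InfiniteGalois.fixingSubgroup_isClosed F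
    have h1 := closure_minimal (SetLike.coe_subset_coe.2 hle) hc
    rw [hS.closure_eq] at h1
    exact h1 (Set.mem_univ σ)
  have hb : q x * q x' ∈ (⊥ : IntermediateField K Ω) := by
    rw [InfiniteGalois.mem_bot_iff_fixed]
    intro σ
    exact (IntermediateField.mem_fixingSubgroup_iff _ _).1 (htop σ) _
      (IntermediateField.mem_adjoin_simple_self K _)
  obtain ⟨z, hz⟩ := IntermediateField.mem_bot.1 hb
  refine ⟨z, (algebraMap K Ω).injective ?_⟩
  rw [map_pow, hz, mul_pow, hq, hq, map_mul]

/-- If `K` is a field of characteristic different from `2` whose absolute Galois group is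
topologically finitely generated, `g : ℕ`, and `a₁, …, a_{2g+2}` are pairwise distinct elements
of `K`, then there exist a finite set `C ⊆ K` and a finite set `L` of pairs `(r, s)` with `s ≠ 0`
(encoding the degree-one polynomials `λ(t) = (t - r)/s`) such that for every `c ∈ K \ C` there
are `(r, s) ∈ L` and `y ∈ K` with `y² = ∏ⱼ ((c - r)/s - aⱼ)`. -/
theorem stmt_1 (K : Type*) [Field K] (hchar : ringChar K ≠ 2)
    (Ω : Type*) [Field Ω] [Algebra K Ω] [IsSepClosure K Ω]
    (htfg : ∃ S : Finset (Ω ≃ₐ[K] Ω),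
      Dense ((Subgroup.closure (S : Set (Ω ≃ₐ[K] Ω)) : Subgroup (Ω ≃ₐ[K] Ω)) : Set (Ω ≃ₐ[K] Ω)))
    (g : ℕ) (a : Fin (2 * g + 2) → K) (ha : Function.Injective a) :
    ∃ (C : Finset K) (L : Finset (K × K)), (∀ p ∈ L, p.2 ≠ 0) ∧
      ∀ c : K, c ∉ C → ∃ p ∈ L, ∃ y : K,
        y ^ 2 = ∏ j : Fin (2 * g + 2), ((c - p.1) / p.2 - a j) := by
  classical
  obtain ⟨S, hS⟩ := htfg
  rcases finite_or_infinite K with hK | hK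
  · let _ := Fintype.ofFinite K
    exact ⟨Finset.univ, ∅, by simp, fun c hc => absurd (Finset.mem_univ c) hc⟩
  obtain ⟨f, hf⟩ := aux_color K hchar Ω S hS
  obtain ⟨ι, _, hι⟩ :=
    Combinatorics.Line.exists_mono_in_high_dimension (Fin (2 * g + 2)) (S → Prop)
  obtain ⟨w, hw⟩ := aux_weights K ι
  -- the lines, as functions `ι → Option (Fin (2g+2))`
  let A : (ι → Option (Fin (2 * g + 2))) → Finset ι := fun l => Finset.univ.filter (fun i => l i = none)
  let R : (ι → Option (Fin (2 * g + 2))) → K := fun l => ∑ i, w i * ((l i).map a).getD 0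
  let T : (ι → Option (Fin (2 * g + 2))) → K := fun l => ∑ i ∈ A l, w i
  let X : (ι → Fin (2 * g + 2)) → K := fun v => ∑ i, w i * a (v i)
  refine ⟨Finset.univ.image X,
    (Finset.univ.filter (fun l => (A l).Nonempty)).image (fun l => (R l, T l)), ?_, ?_⟩
  · intro p hp
    obtain ⟨l, hl, rfl⟩ := Finset.mem_image.1 hp
    exact hw _ (Finset.mem_filter.1 hl).2
  intro c hc
  obtain ⟨l, k, hk⟩ := hι (fun v => f (c - X v))
  have hA : (A l.idxFun).Nonempty := by
    obtain ⟨i, hi⟩ := l.proper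
    exact ⟨i, by simp [A, hi]⟩
  have hT : T l.idxFun ≠ 0 := hw _ hA
  refine ⟨(R l.idxFun, T l.idxFun), Finset.mem_image.2 ⟨l.idxFun, by simp [hA], rfl⟩, ?_⟩
  have hX : ∀ j, X (l j) = R l.idxFun + T l.idxFun * a j := by
    intro j
    simp only [X, R, T, A, Finset.sum_filter, Finset.sum_mul, ← Finset.sum_add_distrib]
    refine Finset.sum_congr rfl fun i _ => ?_
    rw [Combinatorics.Line.apply_def]
    rcases h : l.idxFun i with _ | b <;> simp [h]
  have hne : ∀ j, c - X (l j) ≠ 0 := by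
    intro j h0
    exact hc (Finset.mem_image.2 ⟨l j, Finset.mem_univ _, (sub_eq_zero.1 h0).symm⟩)
  choose z hz using fun j => hf (c - X (l j)) (c - X (l 0)) ((hk j).trans (hk 0).symm)
  set u := c - X (l 0) with hu
  have hu0 : u ≠ 0 := hne 0
  refine ⟨(∏ j, z j) / (u ^ (g + 1) * T l.idxFun ^ (g + 1)), ?_⟩
  have key : ∀ j, (c - R l.idxFun) / T l.idxFun - a j = z j ^ 2 / (u * T l.idxFun) := by
    intro j
    rw [hz, hX]
    field_simp
    ring
  simp only [key, Finset.prod_div_distrib, Finset.prod_const, Finset.card_univ, Fintype.card_fin,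
    Finset.prod_pow, div_pow]
  congr 1
  ring
end

section
/- Let K be an infinite field of characteristic different from 2 whose absolute Galois group Gal(K^sep/K) is topologically finitely generated. Let g be a natural number and let a_1, …, a_{2g+2} be pairwise distinct elements of K. Then the set {(x, y) ∈ K × K : y^2 = (x − a_1)(x − a_2)⋯(x − a_{2g+2})} is infinite. -/
open Polynomial in
theorem exists_generic_weights (K : Type*) [Field K] [Infinite K] (ι : Type) [Fintype ι] :
    ∃ w : ι → K, ∀ s : Finset ι, s.Nonempty → ∑ i ∈ s, w i ≠ 0 := by
  classical
  let e := Fintype.equivFin ι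
  let P : Finset ι → K[X] := fun s => ∑ i ∈ s, X ^ (e i : ℕ)
  have hP : ∀ s : Finset ι, s.Nonempty → P s ≠ 0 := by
    rintro s ⟨i, hi⟩ h
    have h1 : (P s).coeff (e i : ℕ) = 1 := by
      simp only [P, finsetSum_coeff, coeff_X_pow]
      rw [Finset.sum_eq_single i]
      · simp
      · intro b _ hb
        rw [if_neg]
        intro h
        exact hb (e.injective (Fin.ext h)).symm
      · intro h; exact absurd hi h
    rw [h] at h1
    simp at h1
  obtain ⟨u, hu⟩ := Infinite.exists_notMem_finset
    ((Finset.univ : Finset (Finset ι)).biUnion fun s => (P s).roots.toFinset)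
  refine ⟨fun i => u ^ (e i : ℕ), fun s hs h0 => hu ?_⟩
  simp only [Finset.mem_biUnion, Finset.mem_univ, true_and, Multiset.mem_toFinset]
  refine ⟨s, ?_⟩
  rw [mem_roots (hP s hs)]
  simp only [P, IsRoot, eval_finsetSum, eval_pow, eval_X]
  exact h0

theorem exists_square_coloring (K : Type*) [Field K] (hchar : ringChar K ≠ 2)
    (Ω : Type*) [Field Ω] [Algebra K Ω] [IsSepClosure K Ω]
    (S : Finset (Ω ≃ₐ[K] Ω))
    (hS : Dense ((Subgroup.closure (S : Set (Ω ≃ₐ[K] Ω)) : Subgroup (Ω ≃ₐ[K] Ω)) :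
      Set (Ω ≃ₐ[K] Ω))) :
    ∃ C : K → (S → Prop), ∀ d e, C d = C e → IsSquare (d * e) := by
  have : IsSepClosed Ω := IsSepClosure.sep_closed K
  have : Algebra.IsSeparable K Ω := IsSepClosure.separable
  have : IsGalois K Ω := IsSepClosure.isGalois
  have h2K : (2 : K) ≠ 0 := Ring.two_ne_zero hchar
  have h2 : (2 : Ω) ≠ 0 := by
    have := (map_ne_zero (algebraMap K Ω)).2 h2K
    rwa [map_ofNat] at this
  have : NeZero (2 : Ω) := ⟨h2⟩
  choose r hr using fun d : K => IsSepClosed.exists_eq_mul_self (algebraMap K Ω d)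
  refine ⟨fun d σ => σ.1 (r d) = r d, fun d e hde => ?_⟩
  have hsign : ∀ (σ : Ω ≃ₐ[K] Ω) d, σ (r d) = r d ∨ σ (r d) = - r d := by
    intro σ d
    apply mul_self_eq_mul_self_iff.1
    rw [← map_mul, ← hr, AlgEquiv.commutes]
  have hfixS : ∀ σ ∈ S, σ (r d * r e) = r d * r e := by
    intro σ hσ
    have h := congrFun hde ⟨σ, hσ⟩
    simp only [eq_iff_iff] at h
    rw [map_mul]
    rcases hsign σ d with h1 | h1
    · rw [h1, h.1 h1]
    · rcases hsign σ e with h3 | h3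
      · rw [h3, h.2 h3]
      · rw [h1, h3]; ring
  have hfix : ∀ σ : Ω ≃ₐ[K] Ω, σ (r d * r e) = r d * r e := by
    let E := IntermediateField.adjoin K {r d * r e}
    have hcl : IsClosed (E.fixingSubgroup : Set (Ω ≃ₐ[K] Ω)) :=
      InfiniteGalois.fixingSubgroup_isClosed E
    have hle : Subgroup.closure (S : Set (Ω ≃ₐ[K] Ω)) ≤ E.fixingSubgroup := by
      rw [Subgroup.closure_le]
      intro σ hσ
      simp only [SetLike.mem_coe]
      rw [← Subgroup.zpowers_le, ← IntermediateField.le_iff_le,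
        IntermediateField.adjoin_le_iff]
      rintro _ rfl
      simp only [SetLike.mem_coe, IntermediateField.mem_fixedField_iff]
      intro f hf
      have : Subgroup.zpowers σ ≤ MulAction.stabilizer (Ω ≃ₐ[K] Ω) (r d * r e) := by
        rw [Subgroup.zpowers_le]
        exact hfixS σ hσ
      exact this hf
    intro σ
    have hσ : σ ∈ (E.fixingSubgroup : Set (Ω ≃ₐ[K] Ω)) :=
      closure_minimal (fun x hx => hle hx) hcl (hS σ)
    exact (IntermediateField.mem_fixingSubgroup_iff _ _).1 hσ _
      (IntermediateField.mem_adjoin_simple_self K _)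
  obtain ⟨k, hk⟩ := (InfiniteGalois.mem_range_algebraMap_iff_fixed (r d * r e)).2 hfix
  refine ⟨k, (algebraMap K Ω).injective ?_⟩
  rw [map_mul, map_mul, hk, hr, hr]
  ring

theorem isSquare_prod_of_pairs {K : Type*} [Field K] (g : ℕ) (v : Fin (2 * g + 2) → K)
    (h : ∀ i j, IsSquare (v i * v j)) : IsSquare (∏ j, v j) := by
  induction g with
  | zero =>
    rw [show (∏ j, v j) = v 0 * v 1 from Fin.prod_univ_two v]
    exact h 0 1
  | succ n ih =>
    have := ih (fun j => v j.succ.succ) (fun i j => h _ _)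
    have h3 : ∏ j, v j = v 0 * v (Fin.succ 0) * ∏ j : Fin (2 * n + 2), v j.succ.succ := by
      rw [mul_assoc]
      exact (Fin.prod_univ_succ (n := 2 * n + 3) v).trans
        (congrArg _ (Fin.prod_univ_succ (n := 2 * n + 2) fun j => v j.succ))
    rw [h3]
    exact (h _ _).mul this

/-- If `K` is an infinite field of characteristic different from `2` whose absolute Galois group
is topologically finitely generated, `g : ℕ`, and `a₁, …, a_{2g+2}` are pairwise distinct
elements of `K`, then the set of `K`-points `(x, y)` with `y² = (x - a₁)⋯(x - a_{2g+2})`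
is infinite. -/
theorem stmt_3 (K : Type*) [Field K] [Infinite K] (hchar : ringChar K ≠ 2)
    (Ω : Type*) [Field Ω] [Algebra K Ω] [IsSepClosure K Ω]
    (htfg : ∃ S : Finset (Ω ≃ₐ[K] Ω),
      Dense ((Subgroup.closure (S : Set (Ω ≃ₐ[K] Ω)) : Subgroup (Ω ≃ₐ[K] Ω)) : Set (Ω ≃ₐ[K] Ω)))
    (g : ℕ) (a : Fin (2 * g + 2) → K) (ha : Function.Injective a) :
    {p : K × K | p.2 ^ 2 = ∏ j : Fin (2 * g + 2), (p.1 - a j)}.Infinite := by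
  classical
  obtain ⟨S, hS⟩ := htfg
  obtain ⟨C, hC⟩ := exists_square_coloring K hchar Ω S hS
  obtain ⟨ι, _, hι⟩ :=
    Combinatorics.Line.exists_mono_in_high_dimension (Fin (2 * g + 2)) (S → Prop)
  obtain ⟨w, hw⟩ := exists_generic_weights K ι
  suffices hX : {x : K | IsSquare (∏ j, (x - a j))}.Infinite by
    refine Set.Infinite.of_image Prod.fst (hX.mono ?_)
    rintro x ⟨y, hy⟩
    exact ⟨(x, y), by simp only [Set.mem_ofPred_eq]; rw [hy]; ring, rfl⟩
  intro hfin
  let T : (ι → Option (Fin (2 * g + 2))) → K :=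
    fun l => ∑ i ∈ Finset.univ.filter (fun i => l i = none), w i
  let c : (ι → Option (Fin (2 * g + 2))) → K :=
    fun l => ∑ i, w i * ((l i).map a).getD 0
  obtain ⟨μ, hμ⟩ := Infinite.exists_notMem_finset
    ((Finset.univ ×ˢ hfin.toFinset).image
      fun p : (ι → Option (Fin (2 * g + 2))) × K => - c p.1 - p.2 * T p.1)
  obtain ⟨l, col, hl⟩ := hι fun v => C (μ + ∑ i, w i * a (v i))
  have hval : ∀ j, μ + ∑ i, w i * a (l j i) = μ + c l.idxFun + T l.idxFun * a j := by
    intro j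
    simp only [c, T, Finset.sum_filter, Finset.sum_mul]
    rw [add_assoc, ← Finset.sum_add_distrib]
    congr 1
    refine Finset.sum_congr rfl fun i _ => ?_
    rw [Combinatorics.Line.coe_apply]
    cases h : l.idxFun i <;> simp
  have hT : T l.idxFun ≠ 0 := by
    apply hw
    obtain ⟨i, hi⟩ := l.proper
    exact ⟨i, by simp [hi]⟩
  have hsq : ∀ i j, IsSquare ((-(μ + c l.idxFun) / T l.idxFun - a i) *
      (-(μ + c l.idxFun) / T l.idxFun - a j)) := by
    intro i j
    have h := hC _ _ ((hl i).trans (hl j).symm)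
    rw [hval, hval] at h
    obtain ⟨s, hs⟩ := h
    refine ⟨s / T l.idxFun, ?_⟩
    rw [div_mul_div_comm, ← hs]
    field_simp
    ring
  apply hμ
  rw [Finset.mem_image]
  refine ⟨(l.idxFun, -(μ + c l.idxFun) / T l.idxFun), ?_, ?_⟩
  · simp only [Finset.mem_product, Finset.mem_univ, true_and, Set.Finite.mem_toFinset,
      Set.mem_ofPred_eq]
    exact isSquare_prod_of_pairs g _ hsq
  · simp only
    field_simp
    ring
end

section
/- Let K be an infinite field of characteristic different from 2 such that the quotient group K^×/(K^×)^2 is finite. Let g be a natural number and let a_1, …, a_{2g+2} be pairwise distinct elements of K. Then the set {x ∈ K : (x − a_1)(x − a_2)⋯(x − a_{2g+2}) is a square in K} is infinite. -/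
/-- In an infinite field there are weights whose nonempty subset sums do not vanish. -/
theorem exists_weights (K : Type*) [Field K] [Infinite K] {ι : Type*} (s : Finset ι) :
    ∃ f : ι → K, ∀ t ⊆ s, t.Nonempty → ∑ i ∈ t, f i ≠ 0 := by
  classical
  induction s using Finset.induction_on with
  | empty =>
    refine ⟨fun _ => 0, fun t ht hne => ?_⟩
    rw [Finset.subset_empty.mp ht] at hne
    simp at hne
  | insert i s hi ih =>
    obtain ⟨f, hf⟩ := ih
    obtain ⟨z, hz⟩ := Infinite.exists_notMem_finset (s.powerset.image fun t => -∑ i ∈ t, f i)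
    have key : ∀ t ⊆ s, ∑ k ∈ t, Function.update f i z k = ∑ k ∈ t, f k := by
      intro t ht
      refine Finset.sum_congr rfl fun k hk => ?_
      rw [Function.update_of_ne]
      rintro rfl
      exact hi (ht hk)
    refine ⟨Function.update f i z, fun t ht hne => ?_⟩
    by_cases hit : i ∈ t
    · have hsub : t.erase i ⊆ s := by
        intro k hk
        have h1 := Finset.mem_erase.mp hk
        exact (Finset.mem_insert.mp (ht h1.2)).resolve_left h1.1
      rw [← Finset.add_sum_erase t _ hit, key _ hsub, Function.update_self]
      intro h0
      exact hz (Finset.mem_image.mpr ⟨t.erase i, Finset.mem_powerset.mpr hsub,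
        (eq_neg_of_add_eq_zero_left h0).symm⟩)
    · have hsub : t ⊆ s := (Finset.subset_insert_iff_of_notMem hit).mp ht
      rw [key t hsub]
      exact hf t hsub hne

/-- Gallai-type statement over an infinite field. -/
theorem exists_mono_affine (K : Type*) [Field K] [Infinite K] (T : Finset K)
    {κ : Type*} [Finite κ] (C : K → κ) :
    ∃ d b : K, d ≠ 0 ∧ ∃ c : κ, ∀ s ∈ T, C (d * s + b) = c := by
  classical
  obtain ⟨ι, hι, h⟩ := Combinatorics.Line.exists_mono_in_high_dimension T κ
  obtain ⟨f, hf⟩ := exists_weights K (Finset.univ : Finset ι)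
  obtain ⟨l, c, hl⟩ := h (fun v => C (∑ i, f i * (v i : K)))
  refine ⟨∑ i with l.idxFun i = none, f i,
    ∑ i, f i * ((l.idxFun i).elim 0 (fun s => (s : K))), ?_, c, fun s hs => ?_⟩
  · apply hf _ (Finset.subset_univ _)
    obtain ⟨i, hi⟩ := l.proper
    exact ⟨i, by simp [hi]⟩
  · rw [← hl ⟨s, hs⟩]
    congr 1
    rw [Finset.sum_filter, Finset.sum_mul, ← Finset.sum_add_distrib]
    refine Finset.sum_congr rfl fun i _ => ?_
    rw [Combinatorics.Line.apply_def]
    cases hh : l.idxFun i <;> simp [hh]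

/-- If `K` is an infinite field of characteristic different from `2` with `Kˣ/(Kˣ)²` finite,
`g : ℕ`, and `a₁, …, a_{2g+2}` are pairwise distinct elements of `K`, then the set of `x ∈ K`
such that `(x - a₁)⋯(x - a_{2g+2})` is a square in `K` is infinite. -/
theorem stmt_4 (K : Type*) [Field K] [Infinite K] (hchar : ringChar K ≠ 2)
    (hQ : Finite (Kˣ ⧸ (powMonoidHom 2 : Kˣ →* Kˣ).range))
    (g : ℕ) (a : Fin (2 * g + 2) → K) (ha : Function.Injective a) :
    {x : K | ∃ y : K, y ^ 2 = ∏ j : Fin (2 * g + 2), (x - a j)}.Infinite := by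
  classical
  intro hfin
  let C : K → Option (Kˣ ⧸ (powMonoidHom 2 : Kˣ →* Kˣ).range) := fun z =>
    if h : z = 0 then none else some (QuotientGroup.mk (Units.mk0 z h))
  have hC0 : ∀ z, C z = none ↔ z = 0 := by
    intro z
    by_cases h : z = 0 <;> simp [C, h]
  have hC : ∀ z w, w ≠ 0 → C z = C w → ∃ u : K, z = w * u ^ 2 := by
    intro z w hw h
    have hz : z ≠ 0 := by
      intro hz
      rw [(hC0 z).mpr hz] at h
      exact hw ((hC0 w).mp h.symm)
    simp only [C, hz, hw, dif_neg, not_false_eq_true, Option.some.injEq] at h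
    obtain ⟨u, hu⟩ := QuotientGroup.eq.mp h.symm
    refine ⟨u, ?_⟩
    have := congrArg (fun v : Kˣ => (v : K)) hu
    simp at this
    rw [this]
    field_simp
  obtain ⟨d, b, hd, c, hc⟩ := exists_mono_affine K (Finset.univ.image a ∪ hfin.toFinset) C
  have hca : ∀ j, C (d * a j + b) = c := fun j => hc _ (by simp)
  have hcne : c ≠ none := by
    rintro rfl
    have h0 := (hC0 _).mp (hca 0)
    have h1 := (hC0 _).mp (hca 1)
    have h2 : d * a 0 = d * a 1 := add_right_cancel (h0.trans h1.symm)
    have h3 := ha (mul_left_cancel₀ hd h2)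
    simp [Fin.ext_iff] at h3
  have hw : d * a 0 + b ≠ 0 := by
    intro h
    exact hcne ((hca 0).symm.trans ((hC0 _).mpr h))
  have hu : ∀ j, ∃ u : K, d * a j + b = (d * a 0 + b) * u ^ 2 :=
    fun j => hC _ _ hw ((hca j).trans (hca 0).symm)
  choose u hu using hu
  have hmem : (-b / d) ∈ {x : K | ∃ y : K, y ^ 2 = ∏ j : Fin (2 * g + 2), (x - a j)} := by
    refine ⟨(-(d * a 0 + b) / d) ^ (g + 1) * ∏ j, u j, ?_⟩
    have : ∀ j, -b / d - a j = (-(d * a 0 + b) / d) * u j ^ 2 := by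
      intro j
      field_simp
      linear_combination - hu j
    rw [Finset.prod_congr rfl (fun j _ => this j), Finset.prod_mul_distrib, Finset.prod_const,
      Finset.prod_pow, Finset.card_univ, Fintype.card_fin]
    ring
  have := hc (-b / d) (Finset.mem_union_right _ (hfin.mem_toFinset.mpr hmem))
  apply hcne
  rw [← this, hC0]
  field_simp
  ring
end

section
/- Let R_0 be a commutative ring that is finitely generated as a ℤ-algebra, and let φ : R_0 → R be a ring homomorphism to a commutative ring R such that R is infinite and R is finitely generated as a module over the image φ(R_0). Then there exist infinitely many maximal ideals m of R such that the residue field R/m is finite, the quotient R_0/φ^{-1}(m) is finite, and |R/m| = |R_0/φ^{-1}(m)|. -/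
section Aux
open Polynomial

theorem aux_root (D : Type*) [CommRing D] [IsDomain D] [Infinite D] [Finite Dˣ]
    (f : D[X]) (hf : f.natDegree ≠ 0) (s : D) (hs : s ≠ 0) :
    ∃ (p : Ideal D) (a : D), p.IsMaximal ∧ s ∉ p ∧ f.eval a ∈ p := by
  have hf0 : f ≠ 0 := by rintro rfl; simp at hf
  obtain ⟨a0, ha0⟩ : ∃ a0, f.eval a0 ≠ 0 := by
    by_contra! h
    exact hf0 (Polynomial.funext (by simpa using h))
  set c := f.eval a0 with hc
  have key : ∀ t : D, ∃ w, f.eval (a0 + c * s * t) = c * (1 + s * (t * w)) := by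
    intro t
    obtain ⟨w, hw⟩ := Polynomial.sub_dvd_eval_sub (a0 + c * s * t) a0 f
    refine ⟨w, ?_⟩
    rw [← hc] at hw
    linear_combination hw
  choose w hw using key
  by_cases hu : ∀ t, IsUnit (1 + s * (t * w t))
  · exfalso
    choose u hu using hu
    obtain ⟨v, hv⟩ := Finite.exists_infinite_fiber u
    have hinf : Set.Infinite {x | (f - C (c * (v : D))).IsRoot x} := by
      have h1 : (u ⁻¹' {v}).Infinite := Set.infinite_coe_iff.mp hv
      have h2 : Set.InjOn (fun t => a0 + c * s * t) (u ⁻¹' {v}) := by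
        intro x _ y _ hxy
        simpa [ha0, hs] using hxy
      refine (h1.image h2).mono ?_
      rintro _ ⟨t, ht, rfl⟩
      have ht : u t = v := ht
      simp [hw, ← hu, ht]
    have := Polynomial.eq_zero_of_infinite_isRoot _ hinf
    rw [sub_eq_zero] at this
    rw [this] at hf
    exact hf (Polynomial.natDegree_C _)
  · push Not at hu
    obtain ⟨t, ht⟩ := hu
    obtain ⟨p, hp, hmem⟩ := exists_max_ideal_of_mem_nonunits ht
    refine ⟨p, a0 + c * s * t, hp, ?_, ?_⟩
    · intro hsp
      apply hp.ne_top
      rw [Ideal.eq_top_iff_one]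
      have := p.sub_mem hmem (p.mul_mem_right (t * w t) hsp)
      simpa using this
    · rw [hw]; exact p.mul_mem_left _ hmem

theorem aux_clear (D F L : Type*) [CommRing D] [IsDomain D] [Field F]
    [Algebra D F] [IsFractionRing D F] [Field L] [Algebra F L] [Algebra D L]
    [IsScalarTower D F L] (θ : L) (hθ : Algebra.adjoin F {θ} = ⊤) (y : L) :
    ∃ (d : D) (P : D[X]), d ≠ 0 ∧ aeval θ P = algebraMap D L d * y := by
  have hy : y ∈ Algebra.adjoin F {θ} := by rw [hθ]; trivial
  rw [Algebra.adjoin_singleton_eq_range_aeval] at hy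
  obtain ⟨Q, rfl⟩ := hy
  obtain ⟨b, hbm, hb⟩ := IsLocalization.integerNormalization_spec (nonZeroDivisors D) Q
  refine ⟨b, IsLocalization.integerNormalization (nonZeroDivisors D) Q, nonZeroDivisors.ne_zero hbm, ?_⟩
  rw [← Polynomial.aeval_map_algebraMap F, hb]
  rw [← Algebra.smul_def, ← algebraMap_smul F b Q, map_smul, algebraMap_smul]
  rfl

theorem aux_prim (D F L : Type*) [CommRing D] [IsDomain D] [Field F]
    [Algebra D F] [IsFractionRing D F] [Field L] [Algebra F L] [Algebra D L]
    [IsScalarTower D F L] [FiniteDimensional F L] [Algebra.IsSeparable F L] :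
    ∃ θ : L, IsIntegral D θ ∧ Algebra.adjoin F {θ} = ⊤ := by
  obtain ⟨α, hα⟩ := Field.exists_primitive_element F L
  have hα' : Algebra.adjoin F {α} = ⊤ := by
    rw [← IntermediateField.adjoin_simple_toSubalgebra_of_isAlgebraic
      (Algebra.IsAlgebraic.isAlgebraic α), hα, IntermediateField.top_toSubalgebra]
  have : IsAlgebraic D α := by
    rw [IsFractionRing.isAlgebraic_iff D F L]
    exact Algebra.IsAlgebraic.isAlgebraic α
  obtain ⟨d, hd, hi⟩ := this.exists_integral_multiple
  refine ⟨d • α, hi, ?_⟩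
  rw [eq_top_iff, ← hα']
  apply Algebra.adjoin_le
  rw [Set.singleton_subset_iff]
  have : α = (algebraMap D F d)⁻¹ • (d • α) := by
    rw [← algebraMap_smul F d α, smul_smul, inv_mul_cancel₀, one_smul]
    simpa using hd
  have h2 : (algebraMap D F d)⁻¹ • (d • α) ∈ Algebra.adjoin F {d • α} :=
    Subalgebra.smul_mem _ (Algebra.subset_adjoin (Set.mem_singleton _)) _
  rw [← this] at h2
  exact h2

theorem aux_hom (D F L : Type*) [CommRing D] [IsDomain D] [IsIntegrallyClosed D] [Infinite D]
    [Finite Dˣ] [Field F]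
    [Algebra D F] [IsFractionRing D F] [Field L] [Algebra F L] [Algebra D L]
    [IsScalarTower D F L] [FiniteDimensional F L] [Algebra.IsSeparable F L]
    (B : Type*) [CommRing B] [Algebra.FiniteType ℤ B] (g : B →+* L) (s0 : D) (hs0 : s0 ≠ 0) :
    ∃ (p : Ideal D) (h : B →+* D ⧸ p), p.IsMaximal ∧ s0 ∉ p ∧
      ∀ b d, g b = algebraMap D L d → h b = Ideal.Quotient.mk p d := by
  obtain ⟨θ, hθ, hgen⟩ := aux_prim D F L
  obtain ⟨S, hS⟩ := (‹Algebra.FiniteType ℤ B›).out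
  choose d P hd hP using fun b => aux_clear D F L θ hgen (g b)
  have hinjL : Function.Injective (algebraMap D L) := by
    rw [IsScalarTower.algebraMap_eq D F L]
    exact (algebraMap F L).injective.comp (IsFractionRing.injective D F)
  have : Module.IsTorsionFree D L := by
    exact Module.isTorsionFree_iff_algebraMap_injective.mpr hinjL
  set s := s0 * ∏ b ∈ S, d b with hs
  have hs' : s ≠ 0 := mul_ne_zero hs0 (Finset.prod_ne_zero_iff.mpr fun b _ => hd b)
  set f := minpoly D θ with hfdef
  obtain ⟨p, a, hp, hsp, hfa⟩ := aux_root D f (minpoly.natDegree_pos hθ).ne' s hs'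
  have := hp
  let _ : Field (D ⧸ p) := Ideal.Quotient.field p
  have hf0 : eval₂ (algebraMap D L) θ f = 0 := minpoly.aeval D θ
  let e : AdjoinRoot f →+* L := AdjoinRoot.lift (algebraMap D L) θ hf0
  let χ : AdjoinRoot f →+* D ⧸ p := AdjoinRoot.lift (Ideal.Quotient.mk p) (Ideal.Quotient.mk p a)
    (by rw [Polynomial.eval₂_at_apply]; exact Ideal.Quotient.eq_zero_iff_mem.mpr hfa)
  have he : Function.Injective e := by
    rw [injective_iff_map_eq_zero]
    intro x hx
    obtain ⟨Q, rfl⟩ := AdjoinRoot.mk_surjective x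
    rw [AdjoinRoot.mk_eq_zero]
    apply minpoly.isIntegrallyClosed_dvd hθ
    simpa [e, aeval_def] using hx
  have hes : IsUnit (e (AdjoinRoot.of f s)) := by
    simpa [e, isUnit_iff_ne_zero] using hs'
  have hχs : IsUnit (χ (AdjoinRoot.of f s)) := by
    simp [χ, isUnit_iff_ne_zero, Ideal.Quotient.eq_zero_iff_mem, hsp]
  let j : Localization.Away (AdjoinRoot.of f s) →+* L := IsLocalization.Away.lift _ hes
  let ψ : Localization.Away (AdjoinRoot.of f s) →+* D ⧸ p := IsLocalization.Away.lift _ hχs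
  have hj : Function.Injective j := by
    rw [injective_iff_map_eq_zero]
    intro z hz
    obtain ⟨n, x, hx⟩ := IsLocalization.Away.surj (AdjoinRoot.of f s) z
    have h1 := congrArg j hx
    rw [map_mul, hz, zero_mul] at h1
    simp only [j, IsLocalization.Away.lift_eq] at h1
    have : x = 0 := he (by rw [← h1, map_zero])
    rw [this, map_zero] at hx
    exact ((IsLocalization.Away.algebraMap_isUnit (AdjoinRoot.of f s)).pow n).mul_left_eq_zero.mp hx
  have hrange : ∀ b, g b ∈ j.range := by
    intro b
    have hb : b ∈ Algebra.adjoin ℤ (S : Set B) := by rw [hS]; trivial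
    induction hb using Algebra.adjoin_induction with
    | mem x hx =>
      have hu : IsUnit (algebraMap _ (Localization.Away (AdjoinRoot.of f s)) (AdjoinRoot.of f (d x))) := by
        have := (IsLocalization.Away.algebraMap_isUnit (S := Localization.Away (AdjoinRoot.of f s)) (AdjoinRoot.of f s))
        refine isUnit_of_dvd_unit ?_ this
        apply _root_.map_dvd
        apply _root_.map_dvd
        exact (Finset.dvd_prod_of_mem d hx).mul_left _
      obtain ⟨u, hu⟩ := hu
      refine ⟨↑u⁻¹ * algebraMap _ _ (AdjoinRoot.mk f (P x)), ?_⟩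
      have h1 : j (algebraMap _ _ (AdjoinRoot.mk f (P x))) = j u * g x := by
        rw [hu]
        simp only [j, IsLocalization.Away.lift_eq]
        simpa [e, aeval_def] using hP x
      rw [map_mul, h1, ← mul_assoc, ← map_mul]
      simp
    | algebraMap r => simp
    | add x y _ _ hx hy => rw [map_add]; exact add_mem hx hy
    | mul x y _ _ hx hy => exact (g.map_mul x y).symm ▸ mul_mem hx hy
  let E := RingEquiv.ofBijective j.rangeRestrict
    ⟨fun x y h => hj (congrArg Subtype.val h), j.rangeRestrict_surjective⟩
  have hE : ∀ z, j (E.symm z) = z := fun z => congrArg Subtype.val (E.apply_symm_apply z)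
  refine ⟨p, ψ.comp ((E.symm : j.range →+* _).comp (g.codRestrict j.range hrange)), hp,
    fun h => hsp (p.mul_mem_right _ h), ?_⟩
  intro b d hbd
  have : E.symm (g.codRestrict j.range hrange b) = algebraMap _ _ (AdjoinRoot.of f d) := by
    apply hj
    rw [hE]
    simp [j, e, hbd]
  simp only [RingHom.comp_apply, RingHom.coe_coe, this]
  simp [ψ, χ]

theorem aux_field (D F B : Type*) [CommRing D] [IsDomain D] [Field F] [Algebra D F]
    [IsFractionRing D F] [CommRing B] [Algebra D B] [Algebra.FiniteType D B]
    (hinj : Function.Injective (algebraMap D B)) :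
    ∃ (M : Ideal (TensorProduct D F B)), M.IsMaximal ∧
      Module.Finite F (TensorProduct D F B ⧸ M) := by
  have : Nontrivial (TensorProduct D F B) := by
    have : Module.Flat D F := IsLocalization.flat F (nonZeroDivisors D)
    have h := Module.Flat.lTensor_preserves_injective_linearMap (M := F)
      (Algebra.linearMap D B) hinj
    have : Nontrivial (TensorProduct D F D) := (TensorProduct.rid D F).toEquiv.nontrivial
    exact h.nontrivial
  obtain ⟨M, hM⟩ := Ideal.exists_maximal (TensorProduct D F B)
  refine ⟨M, hM, ?_⟩
  let _ : Field (TensorProduct D F B ⧸ M) := Ideal.Quotient.field M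
  exact finite_of_finite_type_of_isJacobsonRing F (TensorProduct D F B ⧸ M)

theorem aux_sep (D F K : Type*) [CommRing D] [IsDomain D] [IsIntegrallyClosed D] [Infinite D]
    [Finite Dˣ] [Field F]
    [Algebra D F] [IsFractionRing D F] [Field K] [Algebra F K] [Algebra D K]
    [IsScalarTower D F K] [FiniteDimensional F K]
    (B : Type*) [CommRing B] [Algebra.FiniteType ℤ B] (g : B →+* K) (s0 : D) (hs0 : s0 ≠ 0) :
    ∃ (q : ℕ) (p : Ideal D) (h : B →+* D ⧸ p), p.IsMaximal ∧ s0 ∉ p ∧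
      ∀ b d, g b = algebraMap D K d → h b = (Ideal.Quotient.mk p d) ^ q := by
  obtain ⟨c, hc⟩ := ExpChar.exists F
  let L := separableClosure F K
  have : ExpChar L c := expChar_of_injective_algebraMap (algebraMap F L).injective c
  let fr : K →+* L := IsPurelyInseparable.iterateFrobenius L K c (le_refl _)
  obtain ⟨p, h, hp, hs, hh⟩ := aux_hom D F L B (fr.comp g) s0 hs0
  refine ⟨c ^ IsPurelyInseparable.exponent L K, p, h, hp, hs, ?_⟩
  intro b d hbd
  rw [hh b (d ^ (c ^ IsPurelyInseparable.exponent L K)), map_pow]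
  rw [RingHom.comp_apply, hbd, IsScalarTower.algebraMap_apply D F K, IsScalarTower.algebraMap_apply F L K]
  simp only [fr]
  rw [IsPurelyInseparable.iterateFrobenius_algebraMap, map_pow, IsScalarTower.algebraMap_apply D F L]

theorem aux_core (D B : Type*) [CommRing D] [IsDomain D] [IsIntegrallyClosed D] [Infinite D]
    [Finite Dˣ] (hD : ∀ p : Ideal D, p.IsMaximal → Finite (D ⧸ p))
    [CommRing B] [Algebra.FiniteType ℤ B] [Algebra D B]
    (hinj : Function.Injective (algebraMap D B)) :
    {m : Ideal B | m.IsMaximal ∧ Finite (B ⧸ m) ∧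
      Function.Surjective ((Ideal.Quotient.mk m).comp (algebraMap D B))}.Infinite := by
  intro hfin
  have : Algebra.FiniteType D B := Algebra.FiniteType.of_restrictScalars_finiteType ℤ D B
  have key : ∀ m : Ideal B, ∃ d : D, d ≠ 0 ∧ (Finite (B ⧸ m) → algebraMap D B d ∈ m) := by
    intro m
    by_cases hm : Finite (B ⧸ m)
    · have hni := not_injective_infinite_finite ((Ideal.Quotient.mk m).comp (algebraMap D B))
      rw [injective_iff_map_eq_zero] at hni
      push Not at hni
      obtain ⟨d, hd, hd0⟩ := hni
      exact ⟨d, hd0, fun _ => Ideal.Quotient.eq_zero_iff_mem.mp hd⟩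
    · exact ⟨1, one_ne_zero, fun h => absurd h hm⟩
  choose d hd hdm using key
  obtain ⟨M, hM, hMf⟩ := aux_field D (FractionRing D) B hinj
  let _ : Field (TensorProduct D (FractionRing D) B ⧸ M) := Ideal.Quotient.field M
  let g : B →ₐ[D] (TensorProduct D (FractionRing D) B ⧸ M) :=
    (Ideal.Quotient.mkₐ D M).comp Algebra.TensorProduct.includeRight
  obtain ⟨q, p, h, hp, hs, hh⟩ := aux_sep D (FractionRing D)
    (TensorProduct D (FractionRing D) B ⧸ M) B g.toRingHom
    (∏ m ∈ hfin.toFinset, d m) (Finset.prod_ne_zero_iff.mpr fun m _ => hd m)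
  have hq : ∀ x : D, h (algebraMap D B x) = (Ideal.Quotient.mk p x) ^ q :=
    fun x => hh _ _ (g.commutes x)
  have := hD p hp
  let _ : Field (D ⧸ p) := Ideal.Quotient.field p
  have hpinj : Function.Injective (fun y : D ⧸ p => y ^ q) := by
    intro y z hyz
    obtain ⟨y, rfl⟩ := Ideal.Quotient.mk_surjective y
    obtain ⟨z, rfl⟩ := Ideal.Quotient.mk_surjective z
    simp only [← hq] at hyz
    rw [← sub_eq_zero, ← map_sub, ← map_sub, hq] at hyz
    have := eq_zero_of_pow_eq_zero hyz
    rwa [map_sub, sub_eq_zero] at this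
  have hsurj : Function.Surjective (h.comp (algebraMap D B)) := by
    intro y
    obtain ⟨z, hz⟩ := Finite.surjective_of_injective hpinj y
    obtain ⟨z, rfl⟩ := Ideal.Quotient.mk_surjective z
    exact ⟨z, (hq z).trans hz⟩
  have hsurj' : Function.Surjective h := fun y => (hsurj y).imp' _ fun _ h => h
  let E := RingHom.quotientKerEquivOfSurjective hsurj'
  have hE : ∀ b, E (Ideal.Quotient.mk _ b) = h b := fun b => rfl
  have hmem : RingHom.ker h ∈ hfin.toFinset := by
    rw [Set.Finite.mem_toFinset]
    refine ⟨RingHom.ker_isMaximal_of_surjective h hsurj', Finite.of_equiv _ E.symm.toEquiv, ?_⟩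
    intro y
    obtain ⟨x, hx⟩ := hsurj (E y)
    exact ⟨x, E.injective hx⟩
  have h1 : algebraMap D B (∏ m ∈ hfin.toFinset, d m) ∈ RingHom.ker h := by
    have h2 : algebraMap D B (d (RingHom.ker h)) ∈ RingHom.ker h :=
      hdm _ ((Set.Finite.mem_toFinset _).mp hmem).2.1
    exact Ideal.mem_of_dvd _ (_root_.map_dvd _ (Finset.dvd_prod_of_mem d hmem)) h2
  rw [RingHom.mem_ker, hq] at h1
  exact hs (Ideal.Quotient.eq_zero_iff_mem.mp (eq_zero_of_pow_eq_zero h1))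

theorem aux_prime (R : Type*) [CommRing R] [IsNoetherianRing R] [Infinite R] :
    ∃ P : Ideal R, P.IsPrime ∧ Infinite (R ⧸ P) := by
  by_contra! hcon
  have hcon' : ∀ P : Ideal R, P.IsPrime → Finite (R ⧸ P) := fun P hP => by
    simpa using hcon P hP
  have : Finite R := by
    refine IsNoetherianRing.induction_on_isQuotientEquivQuotientPrime R
      (M := R) inferInstance (motive := fun N _ _ _ => Finite N) ?_ ?_ ?_
    · intro N _ _ _ _; infer_instance
    · intro N _ _ _ p e
      have := hcon' p.1 p.2
      exact Finite.of_equiv _ e.symm.toEquiv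
    · intro N₁ _ _ _ N₂ _ _ _ N₃ _ _ _ f g hf hg hfg h1 h3
      have : Finite (LinearMap.ker g) := by
        rw [LinearMap.exact_iff.mp hfg]
        exact Finite.of_surjective f.rangeRestrict f.surjective_rangeRestrict
      have hk : Finite (LinearMap.ker g).toAddSubgroup := this
      have : Finite (N₂ ⧸ (LinearMap.ker g).toAddSubgroup) :=
        Finite.of_equiv _ (g.quotKerEquivOfSurjective hg).symm.toEquiv
      exact Finite.of_equiv _ (AddSubgroup.addGroupEquivQuotientProdAddSubgroup
        (s := (LinearMap.ker g).toAddSubgroup)).symm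
  exact not_finite R

theorem aux_domain (A B : Type*) [CommRing A] [CommRing B] [IsDomain B] [Infinite B]
    [Algebra.FiniteType ℤ B] (φ : A →+* B) (hφ : φ.Finite) :
    {m : Ideal B | m.IsMaximal ∧ Finite (B ⧸ m) ∧
      Function.Surjective ((Ideal.Quotient.mk m).comp φ)}.Infinite := by
  obtain ⟨c, hc⟩ := CharP.exists B
  rcases CharP.char_is_prime_or_zero B c with hp | h0
  · have : Fact c.Prime := ⟨hp⟩
    let _ : Algebra (ZMod c) B := ZMod.algebra B c
    have hx : ∃ a : A, Transcendental (ZMod c) (φ a) := by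
      by_contra! hcon
      have hint : Algebra.IsIntegral (ZMod c) B := by
        constructor
        intro b
        let C := integralClosure (ZMod c) B
        have hle : ∀ a, φ a ∈ C := fun a => by
          have : IsAlgebraic (ZMod c) (φ a) := by simpa [Transcendental] using hcon a
          exact this.isIntegral
        have hb : φ.IsIntegralElem b := hφ.to_isIntegral b
        have hb' : IsIntegral C b := by
          obtain ⟨P, hP, hP0⟩ := hb
          refine ⟨P.map (φ.codRestrict C hle), hP.map _, ?_⟩
          rw [Polynomial.eval₂_map]
          exact hP0
        exact isIntegral_trans b hb'
      have : Algebra.FiniteType (ZMod c) B :=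
        Algebra.FiniteType.of_restrictScalars_finiteType ℤ (ZMod c) B
      have : Module.Finite (ZMod c) B := Algebra.IsIntegral.finite
      have : Finite B := Module.finite_of_finite (ZMod c)
      exact not_finite B
    obtain ⟨a, ha⟩ := hx
    let _ : Algebra (ZMod c)[X] B := (aeval (φ a)).toRingHom.toAlgebra
    have hinj : Function.Injective (algebraMap (ZMod c)[X] B) :=
      transcendental_iff_injective.mp ha
    have hunits : Finite (ZMod c)[X]ˣ := by
      have hs : Function.Surjective (Units.map (C : ZMod c →+* (ZMod c)[X]).toMonoidHom) := by
        intro u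
        obtain ⟨r, hr, hru⟩ := Polynomial.isUnit_iff.mp u.isUnit
        exact ⟨hr.unit, Units.ext hru⟩
      exact Finite.of_surjective _ hs
    have hD : ∀ p : Ideal (ZMod c)[X], p.IsMaximal → Finite ((ZMod c)[X] ⧸ p) := by
      intro p hp
      let _ : Field ((ZMod c)[X] ⧸ p) := Ideal.Quotient.field p
      have := finite_of_finite_type_of_isJacobsonRing (ZMod c) ((ZMod c)[X] ⧸ p)
      exact Module.finite_of_finite (ZMod c)
    refine (aux_core (ZMod c)[X] B hD hinj).mono ?_
    rintro m ⟨hm, hmf, hms⟩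
    refine ⟨hm, hmf, ?_⟩
    intro y
    obtain ⟨Q, rfl⟩ := hms y
    have hmem : aeval (φ a) Q ∈ φ.range := by
      rw [aeval_eq_sum_range]
      refine sum_mem fun i _ => ?_
      rw [Algebra.smul_def]
      refine mul_mem ?_ (pow_mem (φ.mem_range_self a) _)
      obtain ⟨n, hn⟩ := ZMod.natCast_zmod_surjective (Q.coeff i)
      rw [← hn, map_natCast]
      exact natCast_mem _ _
    obtain ⟨x, hx⟩ := hmem
    exact ⟨x, congrArg (Ideal.Quotient.mk m) hx⟩
  · subst h0
    have : CharZero B := CharP.charP_to_charZero B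
    have hD : ∀ p : Ideal ℤ, p.IsMaximal → Finite (ℤ ⧸ p) := by
      intro p hp
      refine Ring.HasFiniteQuotients.finiteQuotient ?_
      rintro rfl
      exact Int.not_isField (Ring.isField_iff_maximal_bot.mpr hp)
    refine (aux_core ℤ B hD (by simpa using Int.cast_injective)).mono ?_
    rintro m ⟨hm, hmf, hms⟩
    refine ⟨hm, hmf, ?_⟩
    intro y
    obtain ⟨n, rfl⟩ := hms y
    exact ⟨n, by simp⟩

theorem aux_ft (A B : Type*) [CommRing A] [CommRing B] (hA : Algebra.FiniteType ℤ A)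
    (f : A →+* B) (hf : f.FiniteType) : Algebra.FiniteType ℤ B := by
  have h1 : (algebraMap ℤ A).FiniteType := (RingHom.finiteType_algebraMap).mpr hA
  have h2 := hf.comp h1
  rw [← RingHom.finiteType_algebraMap]
  convert h2
  exact RingHom.ext_int _ _

end Aux

/-- Let `R₀` be a commutative ring which is a finitely generated `ℤ`-algebra and
`φ : R₀ →+* R` a ring homomorphism to a commutative ring `R` which is infinite and finitely
generated as a module over the image of `φ`. Then there are infinitely many maximal ideals
`m` of `R` such that `R/m` and `R₀/φ⁻¹(m)` are finite of the same cardinality. -/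
theorem stmt_6 (R₀ R : Type*) [CommRing R₀] [CommRing R]
    (hR₀ : Algebra.FiniteType ℤ R₀) [Infinite R]
    (φ : R₀ →+* R) (hfin : φ.Finite) :
    {m : Ideal R | m.IsMaximal ∧ Finite (R ⧸ m) ∧ Finite (R₀ ⧸ m.comap φ) ∧
      Nat.card (R ⧸ m) = Nat.card (R₀ ⧸ m.comap φ)}.Infinite := by
  have hR : Algebra.FiniteType ℤ R := aux_ft R₀ R hR₀ φ hfin.finiteType
  have : IsNoetherianRing R := Algebra.FiniteType.isNoetherianRing ℤ R
  obtain ⟨P, hP, hPi⟩ := aux_prime R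
  have hB := aux_ft R (R ⧸ P) hR (Ideal.Quotient.mk P)
    (RingHom.FiniteType.of_surjective _ Ideal.Quotient.mk_surjective)
  have hfin' : ((Ideal.Quotient.mk P).comp φ).Finite :=
    (RingHom.Finite.of_surjective _ Ideal.Quotient.mk_surjective).comp hfin
  have hmain := @aux_domain R₀ (R ⧸ P) _ _ _ _ hB ((Ideal.Quotient.mk P).comp φ) hfin'
  refine (hmain.image (f := Ideal.comap (Ideal.Quotient.mk P))
    (Ideal.comap_injective_of_surjective _ Ideal.Quotient.mk_surjective).injOn).mono ?_
  rintro _ ⟨m, ⟨hm, hmf, hms⟩, rfl⟩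
  let h : R →+* (R ⧸ P) ⧸ m := (Ideal.Quotient.mk m).comp (Ideal.Quotient.mk P)
  have hh : Function.Surjective h :=
    Ideal.Quotient.mk_surjective.comp Ideal.Quotient.mk_surjective
  have hk : Ideal.comap (Ideal.Quotient.mk P) m = RingHom.ker h := by
    rw [← RingHom.comap_ker, Ideal.mk_ker]
  have hk0 : Ideal.comap φ (Ideal.comap (Ideal.Quotient.mk P) m) = RingHom.ker (h.comp φ) := by
    rw [hk, RingHom.comap_ker]
  let E := (Ideal.quotEquivOfEq hk).trans (RingHom.quotientKerEquivOfSurjective hh)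
  have hs0 : Function.Surjective (h.comp φ) := hms
  let E0 := (Ideal.quotEquivOfEq hk0).trans (RingHom.quotientKerEquivOfSurjective hs0)
  refine ⟨Ideal.comap_isMaximal_of_surjective _ Ideal.Quotient.mk_surjective,
    Finite.of_equiv _ E.symm.toEquiv, Finite.of_equiv _ E0.symm.toEquiv, ?_⟩
  rw [Nat.card_congr E.toEquiv, Nat.card_congr E0.toEquiv]
end

section
/- Let g be a natural number and let F be a finite field of odd cardinality q with q > 2g^2 + 2g + 3 + 2g·⌈√(g^2 + 2g + 3)⌉. Let a_1, …, a_{2g+2} be pairwise distinct elements of F. Then there exists x ∈ F such that the product (x − a_1)(x − a_2)⋯(x − a_{2g+2}) is not a square in F; in particular, there is no y ∈ F with y^2 = (x − a_1)⋯(x − a_{2g+2}). -/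
open Polynomial

/-- Bivariate polynomials of degree `< A` in the inner and `< B` in the outer variable. -/
def VV (F : Type*) [Field F] (A B : ℕ) : Submodule F (F[X][X]) where
  carrier := {p | ∀ i j, (A ≤ i ∨ B ≤ j) → (p.coeff j).coeff i = 0}
  zero_mem' := by intro i j _; simp
  add_mem' := by
    intro p q hp hq i j h
    simp [hp i j h, hq i j h]
  smul_mem' := by
    intro c p hp i j h
    simp [hp i j h]

section
variable {F : Type*} [Field F]

lemma VV_mem {A B : ℕ} {p : F[X][X]} :
    p ∈ VV F A B ↔ ∀ i j, (A ≤ i ∨ B ≤ j) → (p.coeff j).coeff i = 0 := Iff.rfl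

lemma VV_mul {A B A' B' A'' B'' : ℕ} {p q : F[X][X]} (hp : p ∈ VV F A B) (hq : q ∈ VV F A' B')
    (hA : A + A' ≤ A'' + 1) (hB : B + B' ≤ B'' + 1) : p * q ∈ VV F A'' B'' := by
  intro i j h
  rw [coeff_mul, finsetSum_coeff]
  refine Finset.sum_eq_zero fun x hx => ?_
  rw [coeff_mul]
  refine Finset.sum_eq_zero fun y hy => ?_
  rw [Finset.HasAntidiagonal.mem_antidiagonal] at hx hy
  by_cases h1 : A ≤ y.1 ∨ B ≤ x.1
  · rw [hp _ _ h1, zero_mul]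
  · rw [hq y.2 x.2 (by omega), mul_zero]

/-- The equivalence with coefficient matrices. -/
noncomputable def VVequiv (A B : ℕ) : VV F A B ≃ₗ[F] (Fin A × Fin B → F) where
  toFun p := fun x => (p.1.coeff x.2).coeff x.1
  map_add' p q := by ext; simp
  map_smul' c p := by ext; simp
  invFun m := ⟨∑ x : Fin A × Fin B, monomial (x.2 : ℕ) (monomial (x.1 : ℕ) (m x)), by
    intro i j h
    simp only [finsetSum_coeff]
    refine Finset.sum_eq_zero fun x _ => ?_
    rw [coeff_monomial]
    split_ifs with h1
    · rw [coeff_monomial, if_neg]; have := x.1.2; have := x.2.2; omega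
    · simp⟩
  left_inv p := by
    ext j i
    simp only [finsetSum_coeff]
    by_cases h : A ≤ i ∨ B ≤ j
    · rw [p.2 i j h]
      refine Finset.sum_eq_zero fun x _ => ?_
      rw [coeff_monomial]
      split_ifs with h1
      · rw [coeff_monomial, if_neg]; have := x.1.2; have := x.2.2; omega
      · simp
    · push Not at h
      rw [Finset.sum_eq_single (⟨⟨i, h.1⟩, ⟨j, h.2⟩⟩ : Fin A × Fin B)]
      · simp
      · rintro ⟨x, y⟩ _ hne
        rw [coeff_monomial]
        split_ifs with h1
        · rw [coeff_monomial, if_neg]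
          intro h2
          apply hne
          ext <;> simp_all
        · simp
      · simp
  right_inv m := by
    ext ⟨i, j⟩
    simp only [finsetSum_coeff]
    rw [Finset.sum_eq_single (⟨i, j⟩ : Fin A × Fin B)]
    · simp
    · rintro ⟨x, y⟩ _ hne
      rw [coeff_monomial]
      split_ifs with h1
      · rw [coeff_monomial, if_neg]
        intro h2
        apply hne
        ext <;> simp_all
      · simp
    · simp

instance VV_fin (A B : ℕ) : FiniteDimensional F (VV F A B) :=
  Module.Finite.equiv (VVequiv A B).symm

lemma VV_finrank (A B : ℕ) : Module.finrank F (VV F A B) = A * B := by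
  rw [(VVequiv A B).finrank_eq]; simp

lemma VV_C {A : ℕ} {p : F[X]} (hp : p.natDegree < A) : (C p : F[X][X]) ∈ VV F A 1 := by
  intro i j h
  rw [coeff_C]
  split_ifs with h1
  · exact coeff_eq_zero_of_natDegree_lt (by omega)
  · simp

lemma VV_map {A : ℕ} {p : F[X]} (hp : p.natDegree < A) : (p.map C : F[X][X]) ∈ VV F 1 A := by
  intro i j h
  rw [coeff_map, coeff_C]
  split_ifs with h1
  · exact coeff_eq_zero_of_natDegree_lt (by omega)
  · rfl

lemma VV_tau : (X - C X : F[X][X]) ∈ VV F 2 2 := by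
  intro i j h
  rw [coeff_sub, coeff_X, coeff_C, coeff_sub]
  have h1 : (if 1 = j then (1 : F[X]) else 0).coeff i = 0 := by
    split_ifs with h1
    · rw [coeff_one, if_neg (by omega)]
    · simp
  have h2 : (if j = 0 then (X : F[X]) else 0).coeff i = 0 := by
    split_ifs with h1
    · rw [coeff_X, if_neg (by omega)]
    · simp
  rw [h1, h2, sub_zero]

lemma VV_div_tau {A B : ℕ} {d : F[X][X]} (h : (X - C X) * d ∈ VV F (A + 1) (B + 1)) :
    d ∈ VV F A B := by
  have hx : ∀ j i, A ≤ i → (d.coeff j).coeff i = 0 := by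
    intro j
    induction j with
    | zero =>
      intro i hi
      have := h (i + 1) 0 (by omega)
      simpa [sub_mul] using this
    | succ j ih =>
      intro i hi
      have := h (i + 1) (j + 1) (by omega)
      simpa [sub_mul, ih (i + 1) (by omega)] using this
  have hy : ∀ j, B ≤ j → d.coeff j = 0 := by
    intro j hj
    by_cases hd : d = 0
    · simp [hd]
    apply coeff_eq_zero_of_natDegree_lt
    by_contra hlt
    have hn : ((X - C X) * d).natDegree = 1 + d.natDegree := by
      rw [(monic_X_sub_C (X : F[X])).natDegree_mul' hd, natDegree_X_sub_C]
    have h0 : ((X - C X) * d).coeff (1 + d.natDegree) = 0 := by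
      ext i
      rw [h i _ (by omega)]; simp
    rw [← hn, coeff_natDegree, leadingCoeff_eq_zero] at h0
    rw [h0] at hn
    simp at hn
    omega
  rintro i j (h1 | h1)
  · exact hx j i h1
  · rw [hy j h1]; simp

lemma VV_eval_natDegree {A B q : ℕ} {p : F[X][X]} (hp : p ∈ VV F A B) :
    p = 0 ∨ (p.eval (X ^ q)).natDegree + 1 + q ≤ A + q * B := by
  by_cases h0 : p = 0
  · exact Or.inl h0
  right
  have key : ∀ j i, (p.coeff j).coeff i ≠ 0 → i < A ∧ j < B := by
    intro j i h
    by_contra h1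
    exact h (hp i j (by omega))
  obtain ⟨j, hj⟩ : ∃ j, p.coeff j ≠ 0 := by
    by_contra! h; exact h0 (by ext1 j; simp [h j])
  obtain ⟨i, hi⟩ : ∃ i, (p.coeff j).coeff i ≠ 0 := by
    by_contra! h; exact hj (by ext1 i; simp [h i])
  obtain ⟨a, rfl⟩ : ∃ a, A = a + 1 := ⟨A - 1, by have := key _ _ hi; omega⟩
  obtain ⟨b, rfl⟩ : ∃ b, B = b + 1 := ⟨B - 1, by have := key _ _ hi; omega⟩
  have : (p.eval (X ^ q)).natDegree ≤ a + q * b := by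
    rw [eval_eq_sum, Polynomial.sum]
    refine natDegree_sum_le_of_forall_le _ _ fun j hj => ?_
    have hj' : j < b + 1 := by
      obtain ⟨i, hi⟩ : ∃ i, (p.coeff j).coeff i ≠ 0 := by
        by_contra! h; exact (mem_support_iff.1 hj) (by ext1 i; simp [h i])
      exact (key _ _ hi).2
    refine natDegree_mul_le.trans ?_
    rw [← pow_mul, natDegree_X_pow]
    refine add_le_add ?_ (Nat.mul_le_mul_left _ (by omega))
    rw [natDegree_le_iff_coeff_eq_zero]
    intro i hi
    exact hp _ _ (by omega)
  nlinarith

lemma VV_eval_inj {B q : ℕ} {p : F[X][X]} (hp : p ∈ VV F q B) (h : p.eval (X ^ q) = 0) :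
    p = 0 := by
  obtain ⟨r, hr⟩ := dvd_iff_isRoot.2 h
  have : ∀ j, r.coeff j = 0 := by
    intro j
    induction j with
    | zero =>
      ext i
      have := hp (i + q) 0 (by omega)
      rw [hr] at this
      simp only [sub_mul, coeff_sub, mul_coeff_zero, coeff_X_zero, zero_mul, coeff_C_zero,
        coeff_X_pow_mul] at this
      simpa using this
    | succ j ih =>
      ext i
      have := hp (i + q) (j + 1) (by omega)
      rw [hr] at this
      simp only [sub_mul, coeff_sub, coeff_X_mul, coeff_C_mul, ih, coeff_X_pow_mul] at this
      simpa using this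
  have hr0 : r = 0 := by ext1 j; simp [this j]
  rw [hr, hr0, mul_zero]

lemma finrank_comap_ge {M V : Type*} [AddCommGroup M] [Module F M] [AddCommGroup V] [Module F V]
    [FiniteDimensional F M] [FiniteDimensional F V] (L : M →ₗ[F] V) (W : Submodule F V) :
    Module.finrank F M + Module.finrank F W ≤
      Module.finrank F (W.comap L) + Module.finrank F V := by
  have h1 := LinearMap.finrank_range_add_finrank_ker (W.mkQ ∘ₗ L)
  rw [LinearMap.ker_comp, Submodule.ker_mkQ] at h1
  have h2 := W.finrank_quotient_add_finrank
  have h3 := Submodule.finrank_le (LinearMap.range (W.mkQ ∘ₗ L))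
  omega
end

section
variable {F : Type*} [Field F]

/-- Recovers `(P, Q)` from `(Q, R)` when `P + Q c = τ² R`. -/
noncomputable def PsiMap (c : F[X][X]) :
    (F[X][X] × F[X][X]) →ₗ[F] (F[X][X] × F[X][X]) where
  toFun z := ((X - C X) ^ 2 * z.2 - z.1 * c, z.1)
  map_add' x y := by ext1 <;> simp <;> ring
  map_smul' k x := by
    ext1
    · simp [smul_sub, mul_smul_comm, smul_mul_assoc]
    · simp

/-- The next pair in the division process. -/
noncomputable def TMap (c d : F[X][X]) :
    (F[X][X] × F[X][X]) →ₗ[F] (F[X][X] × F[X][X]) where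
  toFun z := (z.2 * c - z.1 * d ^ 2, z.2)
  map_add' x y := by ext1 <;> simp <;> ring
  map_smul' k x := by
    ext1
    · simp [smul_sub, smul_mul_assoc]
    · simp

/-- The linear form `P + Q c`. -/
noncomputable def GMap (c : F[X][X]) :
    (F[X][X] × F[X][X]) →ₗ[F] F[X][X] where
  toFun z := z.1 + z.2 * c
  map_add' x y := by simp; ring
  map_smul' k x := by simp [smul_add, smul_mul_assoc]

/-- Multiplication by `τ²`. -/
noncomputable def tauMap : F[X][X] →ₗ[F] F[X][X] where
  toFun z := (X - C X) ^ 2 * z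
  map_add' x y := by ring
  map_smul' k x := by simp [mul_smul_comm]

lemma tau_ne : (X - C X : F[X][X]) ≠ 0 := X_sub_C_ne_zero _

lemma PsiMap_inj (c : F[X][X]) : Function.Injective (PsiMap c) := by
  rw [← LinearMap.ker_eq_bot, LinearMap.ker_eq_bot']
  rintro ⟨Q, R⟩ h
  simp only [PsiMap, LinearMap.coe_mk, AddHom.coe_mk, Prod.mk_eq_zero] at h
  obtain ⟨h1, rfl⟩ := h
  simpa [tau_ne] using h1

lemma TMap_inj (c : F[X][X]) {d : F[X][X]} (hd : d ≠ 0) : Function.Injective (TMap c d) := by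
  rw [← LinearMap.ker_eq_bot, LinearMap.ker_eq_bot']
  rintro ⟨Q, R⟩ h
  simp only [TMap, LinearMap.coe_mk, AddHom.coe_mk, Prod.mk_eq_zero] at h
  obtain ⟨h1, rfl⟩ := h
  simpa [hd] using h1

lemma tauMap_inj : Function.Injective (tauMap (F := F)) := by
  rw [← LinearMap.ker_eq_bot, LinearMap.ker_eq_bot']
  intro R h
  simpa [tauMap, tau_ne] using h

lemma VV_tau_sq : ((X - C X) ^ 2 : F[X][X]) ∈ VV F 3 3 := by
  rw [pow_two]; exact VV_mul VV_tau VV_tau (by omega) (by omega)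

/-- Pairs of polynomials with bounded bidegrees. -/
noncomputable def Box (F : Type*) [Field F] (n A B : ℕ) : Submodule F (F[X][X] × F[X][X]) :=
  (VV F A B).prod (VV F (A - n) (B - n))

/-- Coordinates on a box. -/
noncomputable def BoxEquiv (n A B : ℕ) : Box F n A B ≃ₗ[F]
    ((Fin A × Fin B → F) × (Fin (A - n) × Fin (B - n) → F)) where
  toFun z := (VVequiv A B ⟨z.1.1, z.2.1⟩, VVequiv (A - n) (B - n) ⟨z.1.2, z.2.2⟩)
  map_add' x y := by
    rw [Prod.mk_add_mk, ← map_add, ← map_add]; rfl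
  map_smul' k x := by
    rw [RingHom.id_apply, Prod.smul_mk, ← map_smul, ← map_smul]; rfl
  invFun m := ⟨(((VVequiv A B).symm m.1).1, ((VVequiv (A - n) (B - n)).symm m.2).1),
    ⟨((VVequiv A B).symm m.1).2, ((VVequiv (A - n) (B - n)).symm m.2).2⟩⟩
  left_inv z := by ext1; ext1 <;> simp
  right_inv m := by ext1 <;> simp

lemma Box_fin (n A B : ℕ) : FiniteDimensional F (Box F n A B) :=
  Module.Finite.equiv (BoxEquiv n A B).symm

lemma Box_finrank (n A B : ℕ) :
    Module.finrank F (Box F n A B) = A * B + (A - n) * (B - n) := by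
  rw [(BoxEquiv n A B).finrank_eq]; simp

/-- One division step. -/
lemma step_lemma {n A B : ℕ} {c d : F[X][X]} (hc : c ∈ VV F (n + 1) (n + 1)) (hd : d ∈ VV F n n)
    (hd0 : d ≠ 0) (hn : 1 ≤ n) (hA : 2 ≤ A) (hB : 2 ≤ B) (hAn : n ≤ A) (hBn : n ≤ B)
    (M : Submodule F (F[X][X] × F[X][X])) (hM : M ≤ Box F n A B) [FiniteDimensional F M] :
    ∃ N : Submodule F (F[X][X] × F[X][X]), N.map (PsiMap c) ≤ M ∧
      N.map (TMap c d) ≤ Box F n (A + n - 2) (B + n - 2) ∧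
      FiniteDimensional F (N.map (TMap c d)) ∧
      (Module.finrank F M : ℤ) ≤ Module.finrank F (N.map (TMap c d)) + 2 * (A + B - 2) := by
  have hG : ∀ z ∈ M, GMap c z ∈ VV F A B := by
    intro z hz
    have := hM hz
    exact add_mem this.1 (VV_mul this.2 hc (by omega) (by omega))
  let L : M →ₗ[F] VV F A B := ((GMap c).domRestrict M).codRestrict _ (fun z => hG z.1 z.2)
  let W0 : Submodule F (F[X][X]) := (VV F (A - 2) (B - 2)).map tauMap
  have hW0 : W0 ≤ VV F A B := by
    rintro _ ⟨R, hR, rfl⟩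
    exact VV_mul VV_tau_sq hR (by omega) (by omega)
  let W : Submodule F (VV F A B) := W0.comap (VV F A B).subtype
  have hWr : Module.finrank F W = (A - 2) * (B - 2) := by
    have e1 : Module.finrank F W = Module.finrank F W0 :=
      (Submodule.comapSubtypeEquivOfLe hW0).finrank_eq
    rw [e1, ← VV_finrank (F := F),
      ← (Submodule.equivMapOfInjective tauMap tauMap_inj (VV F (A - 2) (B - 2))).finrank_eq]
  have h1 := finrank_comap_ge (F := F) (M := M) (V := VV F A B) L W
  rw [hWr, VV_finrank] at h1
  let N : Submodule F (F[X][X] × F[X][X]) :=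
    M.comap (PsiMap c) ⊓ (⊤ : Submodule F (F[X][X])).prod (VV F (A - 2) (B - 2))
  have hN1 : N.map (PsiMap c) ≤ M := by
    rintro _ ⟨z, hz, rfl⟩
    exact hz.1
  have hle : (W.comap L).map M.subtype ≤ N.map (PsiMap c) := by
    rintro _ ⟨⟨z, hzM⟩, hz, rfl⟩
    obtain ⟨R, hR, hRe⟩ := hz
    have hRe' : (X - C X) ^ 2 * R = z.1 + z.2 * c := hRe
    have hz' : PsiMap c (z.2, R) = z := by
      ext1
      · change (X - C X) ^ 2 * R - z.2 * c = z.1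
        rw [hRe']; ring
      · rfl
    refine ⟨(z.2, R), ⟨?_, ⟨trivial, hR⟩⟩, hz'⟩
    change PsiMap c (z.2, R) ∈ M
    rw [hz']; exact hzM
  have fin1 : FiniteDimensional F (N.map (PsiMap c)) := Submodule.finiteDimensional_of_le hN1
  have e1 := (Submodule.equivMapOfInjective (PsiMap c) (PsiMap_inj c) N)
  have e2 := (Submodule.equivMapOfInjective (TMap c d) (TMap_inj c hd0) N)
  have h2 := Submodule.finrank_mono hle
  have h3 : Module.finrank F ((W.comap L).map M.subtype) = Module.finrank F (W.comap L) :=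
    (Submodule.equivMapOfInjective M.subtype M.injective_subtype (W.comap L)).finrank_eq.symm
  refine ⟨N, hN1, ?_, Module.Finite.equiv (e1.symm.trans e2), ?_⟩
  · rintro _ ⟨z, hz, rfl⟩
    have hQ : z.1 ∈ VV F (A - n) (B - n) := (hM hz.1).2
    have hR : z.2 ∈ VV F (A - 2) (B - 2) := hz.2.2
    have hdd : d ^ 2 ∈ VV F (2 * n - 1) (2 * n - 1) := by
      rw [pow_two]; exact VV_mul hd hd (by omega) (by omega)
    refine ⟨sub_mem (VV_mul hR hc (by omega) (by omega)) (VV_mul hQ hdd (by omega) (by omega)), ?_⟩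
    have ha : A + n - 2 - n = A - 2 := by omega
    have hb : B + n - 2 - n = B - 2 := by omega
    rw [ha, hb]; exact hR
  · rw [← e2.finrank_eq, e1.finrank_eq]
    obtain ⟨A, rfl⟩ := Nat.exists_eq_add_of_le hA
    obtain ⟨B, rfl⟩ := Nat.exists_eq_add_of_le hB
    rw [h3] at h2
    simp only [Nat.add_sub_cancel_left] at h1
    push_cast
    zify at h1 h2
    linarith

/-- The iterated division process, evaluated at `t = X ^ q`. -/
lemma iter_lemma {n q : ℕ} {c d : F[X][X]} (hc : c ∈ VV F (n + 1) (n + 1)) (hd : d ∈ VV F n n)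
    (hd0 : d ≠ 0) (hn : 1 ≤ n) (S : F[X])
    (hS : S ^ 2 = (c.eval (X ^ q)) ^ 2 - ((X ^ q - X) * d.eval (X ^ q)) ^ 2) (k : ℕ) :
    ∀ (A B : ℕ) (M : Submodule F (F[X][X] × F[X][X])), M ≤ Box F n A B →
      FiniteDimensional F M → (2 ≤ n ∨ k ≤ 1) →
      (1 ≤ k → 2 ≤ A ∧ 2 ≤ B ∧ n ≤ A ∧ n ≤ B) →
      (2 * k * (A + B - 2) + 2 * (n - 2) * k * (k - 1) : ℤ) < Module.finrank F M →
      ∃ z ∈ M, z ≠ 0 ∧ ∃ w ∈ Box F n (A + k * n - 2 * k) (B + k * n - 2 * k),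
        (z.1.eval (X ^ q) + z.2.eval (X ^ q) * S) * (S + c.eval (X ^ q)) ^ k =
          (X ^ q - X) ^ (2 * k) * (w.1.eval (X ^ q) + w.2.eval (X ^ q) * S) := by
  induction k with
  | zero =>
    intro A B M hM fM _ _ hr
    have : M ≠ ⊥ := by
      rintro rfl
      simp at hr
    obtain ⟨z, hz, hz0⟩ := Submodule.exists_mem_ne_zero_of_ne_bot this
    refine ⟨z, hz, hz0, z, by simpa using hM hz, by simp⟩
  | succ k ih =>
    intro A B M hM fM hnk hb hr
    obtain ⟨hA, hB, hAn, hBn⟩ := hb (by omega)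
    obtain ⟨N, hN1, hN2, hN3, hN4⟩ := step_lemma hc hd hd0 hn hA hB hAn hBn M hM
    obtain ⟨z, hz, hz0, w, hw, hzw⟩ := ih _ _ _ hN2 hN3 (by omega) (by omega) (by
      rw [Nat.cast_sub (by omega), Nat.cast_sub (by omega)]
      push_cast at hr ⊢
      nlinarith)
    obtain ⟨y, hy, rfl⟩ := hz
    refine ⟨PsiMap c y, hN1 ⟨y, hy, rfl⟩, ?_, w, ?_, ?_⟩
    · intro h
      rw [← map_zero (PsiMap c)] at h
      apply hz0
      rw [PsiMap_inj c h, map_zero]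
    · have e1 : ∀ A : ℕ, 2 ≤ A → n ≤ A →
          A + n - 2 + k * n - 2 * k = A + (k + 1) * n - 2 * (k + 1) := by
        intro A _ _
        rw [add_mul]; omega
      rw [← e1 A hA hAn, ← e1 B hB hBn]; exact hw
    · have e : ((PsiMap c y).1.eval (X ^ q) + (PsiMap c y).2.eval (X ^ q) * S) *
          (S + c.eval (X ^ q)) =
          (X ^ q - X) ^ 2 * ((TMap c d y).1.eval (X ^ q) + (TMap c d y).2.eval (X ^ q) * S) := by
        simp only [PsiMap, TMap, LinearMap.coe_mk, AddHom.coe_mk, eval_sub, eval_mul, eval_pow,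
          eval_X, eval_C]
        linear_combination (y.1.eval (X ^ q)) * hS
      rw [pow_succ', ← mul_assoc, e, mul_assoc, hzw]
      ring
end

section
variable {F : Type*} [Field F] [Fintype F]

lemma eval_map_C_card (p : F[X]) : (p.map C : F[X][X]).eval (X ^ Fintype.card F) =
    p ^ Fintype.card F := by
  rw [eval_map]
  exact FiniteField.expand_card p

lemma not_sq {u v : F[X]} (P Q : F[X][X]) (h2 : (2 : F) ≠ 0) (hu : u ≠ 0) (hv : v ≠ 0) (a : F)
    (ha : (u * v).rootMultiplicity a = 1)
    (h : P ^ 2 = C (4 * (u * v)) * (u * v).map C * Q ^ 2) : P = 0 ∧ Q = 0 := by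
  by_cases hQ : Q = 0
  · subst hQ
    simpa using h
  exfalso
  have h4 : (4 * (u * v) : F[X]) ≠ 0 := by
    have : (4 : F[X]) = C (2 * 2) := by
      rw [show (2 * 2 : F) = 4 by norm_num]; rfl
    rw [this]
    exact mul_ne_zero (C_ne_zero.2 (mul_ne_zero h2 h2)) (mul_ne_zero hu hv)
  have hC : (C (4 * (u * v)) : F[X][X]) ≠ 0 := C_ne_zero.2 h4
  have hm : ((u * v).map C : F[X][X]) ≠ 0 :=
    (Polynomial.map_ne_zero_iff C_injective).2 (mul_ne_zero hu hv)
  have hP : P ≠ 0 := by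
    rintro rfl
    have h0 : (C (4 * (u * v)) * (u * v).map C * Q ^ 2 : F[X][X]) ≠ 0 :=
      mul_ne_zero (mul_ne_zero hC hm) (pow_ne_zero _ hQ)
    exact h0 (by rw [← h]; simp)
  have e := congrArg (rootMultiplicity (C a)) h
  rw [pow_two, pow_two, rootMultiplicity_mul (mul_ne_zero hP hP),
    rootMultiplicity_mul (mul_ne_zero (mul_ne_zero hC hm) (mul_ne_zero hQ hQ)),
    rootMultiplicity_mul (mul_ne_zero hQ hQ), rootMultiplicity_mul (mul_ne_zero hC hm),
    rootMultiplicity_C, ← Polynomial.eq_rootMultiplicity_map C_injective, ha] at e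
  omega

lemma prod_X_sub_C_card : ∏ b : F, (X - C b) = X ^ Fintype.card F - X := by
  have h1 : 1 < Fintype.card F := Fintype.one_lt_card
  have hm : (X ^ Fintype.card F - X : F[X]).Monic :=
    monic_X_pow_sub (by rw [degree_X]; exact_mod_cast h1)
  have := prod_multiset_X_sub_C_of_monic_of_roots_card_eq hm (by
    rw [FiniteField.roots_X_pow_card_sub_X, FiniteField.X_pow_card_sub_X_natDegree_eq F h1]
    rfl)
  rw [FiniteField.roots_X_pow_card_sub_X] at this
  exact this

set_option maxHeartbeats 2000000 in
lemma core {n r : ℕ} (hn : 1 ≤ n) (hr : Fintype.card F = 2 * r + 1)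
    (hq : 4 * n ^ 2 + 2 < 2 * n + Fintype.card F + 1) {u v : F[X]} (hu : u.Monic) (hv : v.Monic)
    (hun : u.natDegree = n) (hvn : v.natDegree = n) (hcop : ∀ x, ¬ (u.eval x = 0 ∧ v.eval x = 0))
    (a : F) (hua : u.eval a = 0) (ha : (u * v).rootMultiplicity a = 1)
    (hsq : ∀ x, IsSquare (u.eval x * v.eval x)) : False := by
  have hchar : ringChar F ≠ 2 := by
    intro h
    have := FiniteField.even_card_of_char_two h
    omega
  have h2 : (2 : F) ≠ 0 := Ring.two_ne_zero hchar
  have hr0 : r ≠ 0 := by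
    rintro rfl
    have := Fintype.one_lt_card (α := F)
    omega
  set q := Fintype.card F with hqdef
  set c : F[X][X] := C u * v.map C + u.map C * C v with hcdef
  have hWdvd : (X - C X : F[X][X]) ∣ C u * v.map C - u.map C * C v := by
    rw [dvd_iff_isRoot, IsRoot.def]
    simp [eval_map]
  obtain ⟨d, hd⟩ := hWdvd
  have hUV : C u * v.map C ∈ VV F (n + 1) (n + 1) :=
    VV_mul (VV_C (A := n + 1) (by omega)) (VV_map (A := n + 1) (by omega)) (by omega) (by omega)
  have hVU : u.map C * C v ∈ VV F (n + 1) (n + 1) :=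
    VV_mul (VV_map (A := n + 1) (by omega)) (VV_C (A := n + 1) (by omega)) (by omega) (by omega)
  have hcV : c ∈ VV F (n + 1) (n + 1) := add_mem hUV hVU
  have hdV : d ∈ VV F n n := VV_div_tau (by rw [← hd]; exact sub_mem hUV hVU)
  have hd0 : d ≠ 0 := by
    rintro rfl
    rw [mul_zero] at hd
    have e := congrArg (eval (C a)) hd
    have hva : v.eval a ≠ 0 := fun h => hcop a ⟨hua, h⟩
    simp only [eval_sub, eval_mul, eval_C, eval_zero, eval_map, eval₂_hom, hua] at e
    simp [hu.ne_zero, hva] at e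
  have hdq : (X ^ q - X) * d.eval (X ^ q) = u * v ^ q - u ^ q * v := by
    have e := congrArg (eval (X ^ q : F[X])) hd
    simp only [eval_sub, eval_mul, eval_C, eval_X, hqdef, eval_map_C_card] at e
    exact e.symm
  have hcq : c.eval (X ^ q) = u * v ^ q + u ^ q * v := by
    simp only [hcdef, eval_add, eval_mul, eval_C, hqdef, eval_map_C_card]
  set S : F[X] := 2 * (u * v) ^ (r + 1) with hSdef
  have hS : S ^ 2 = (c.eval (X ^ q)) ^ 2 - ((X ^ q - X) * d.eval (X ^ q)) ^ 2 := by
    rw [hdq, hcq, hr]; ring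
  have hE : S + c.eval (X ^ q) = (u * v) * ((u ^ r + v ^ r) ^ 2) := by
    rw [hcq, hr]; ring
  -- the initial space
  set A := 2 * n ^ 2 - n + 1 with hA
  have hnn : n ≤ n ^ 2 := by nlinarith
  have hbox := Box_finrank (F := F) n A (2 * n)
  have hboxfin := Box_fin (F := F) n A (2 * n)
  obtain ⟨z, hz, hz0, w, hw, hzw⟩ := iter_lemma hcV hdV hd0 hn S hS n A (2 * n)
    (Box F n A (2 * n)) le_rfl hboxfin (by omega) (by omega) (by
      rw [hbox]
      have e1 : ((A : ℕ) : ℤ) = 2 * n ^ 2 - n + 1 := by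
        rw [hA]; push_cast [Nat.cast_sub (show n ≤ 2 * n ^ 2 by omega)]; ring
      have e2 : ((A - n : ℕ) : ℤ) = 2 * n ^ 2 - 2 * n + 1 := by
        rw [Nat.cast_sub (by omega), e1]; ring
      have e3 : ((2 * n - n : ℕ) : ℤ) = n := by
        rw [Nat.cast_sub (by omega)]; push_cast; ring
      push_cast
      rw [e1, e2, e3]
      have : (1 : ℤ) ≤ n := by exact_mod_cast hn
      nlinarith)
  have hh0 : z.1.eval (X ^ q) + z.2.eval (X ^ q) * S ≠ 0 := by
    intro h0
    apply hz0
    have hzz : z.1 ^ 2 = C (4 * (u * v)) * (u * v).map C * z.2 ^ 2 := by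
      rw [← sub_eq_zero]
      have hP : z.1 ∈ VV F A (2 * n) := hz.1
      have hQ : z.2 ∈ VV F (A - n) (2 * n - n) := hz.2
      refine VV_eval_inj (q := q) (B := 4 * n) (sub_mem ?_ ?_) ?_
      · rw [pow_two]; exact VV_mul hP hP (by omega) (by omega)
      · have hQQ : z.2 ^ 2 ∈ VV F (2 * (A - n) - 1) (2 * n - 1) := by
          rw [pow_two]; exact VV_mul hQ hQ (by omega) (by omega)
        have huv : (u * v).natDegree < 2 * n + 1 := by
          rw [hu.natDegree_mul hv]; omega
        have h4uv : (4 * (u * v)).natDegree < 2 * n + 1 := by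
          refine lt_of_le_of_lt natDegree_mul_le ?_
          have : (4 : F[X]).natDegree = 0 := natDegree_ofNat 4
          omega
        have := VV_mul (A'' := 2 * n + 1) (B'' := 2 * n + 1) (VV_C h4uv) (VV_map huv)
          (by omega) (by omega)
        exact VV_mul this hQQ (by omega) (by omega)
      · simp only [eval_sub, eval_mul, eval_pow, eval_C, hqdef, eval_map_C_card]
        rw [← hqdef]
        have e : z.1.eval (X ^ q) = - (z.2.eval (X ^ q) * S) := by linear_combination h0
        rw [e, hr]
        ring
    have := not_sq z.1 z.2 h2 hu.ne_zero hv.ne_zero a ha hzz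
    exact Prod.ext this.1 this.2
  have hval : ∀ p : F, p ≠ 0 → p ^ r = 1 ∨ p ^ r = -1 := by
    intro p hp
    have := FiniteField.pow_dichotomy hchar hp
    rwa [← hqdef, show q / 2 = r by omega] at this
  have hcopE : IsCoprime ((u ^ r + v ^ r) ^ 2) (X ^ q - X : F[X]) := by
    rw [hqdef, ← prod_X_sub_C_card]
    refine IsCoprime.pow_left (IsCoprime.prod_right fun b _ => ?_)
    rw [isCoprime_comm, (irreducible_X_sub_C b).coprime_iff_not_dvd, dvd_iff_isRoot, IsRoot.def]
    simp only [eval_add, eval_pow]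
    intro h0
    by_cases hub : u.eval b = 0
    · have hvb : v.eval b ≠ 0 := fun h => hcop b ⟨hub, h⟩
      rw [hub, zero_pow hr0, zero_add] at h0
      exact pow_ne_zero _ hvb h0
    by_cases hvb : v.eval b = 0
    · rw [hvb, zero_pow hr0, add_zero] at h0
      exact pow_ne_zero _ hub h0
    have h1 : (u.eval b * v.eval b) ^ r = 1 := by
      have := (FiniteField.isSquare_iff hchar (mul_ne_zero hub hvb)).1 (hsq b)
      rwa [← hqdef, show q / 2 = r by omega] at this
    rw [mul_pow] at h1
    rcases hval _ hub with h | h <;> rw [h] at h0 h1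
    · rw [one_mul] at h1
      rw [h1] at h0
      exact h2 (by linear_combination h0)
    · have h3 : v.eval b ^ r = -1 := by linear_combination -h1
      rw [h3] at h0
      exact h2 (by linear_combination -h0)
  rw [hE] at hzw
  set h' := w.1.eval (X ^ q) + w.2.eval (X ^ q) * S with hh'
  have hdvd : ((u ^ r + v ^ r) ^ 2) ^ n ∣ h' := by
    have h3 : IsCoprime (((u ^ r + v ^ r) ^ 2) ^ n) ((X ^ q - X : F[X]) ^ (2 * n)) :=
      IsCoprime.pow hcopE
    refine h3.dvd_of_dvd_mul_left ?_
    rw [← hzw, mul_pow]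
    exact Dvd.intro_left (_ * (u * v) ^ n) (by rw [mul_assoc])
  have hEdeg : n * r ≤ (u ^ r + v ^ r).natDegree := by
    apply le_natDegree_of_ne_zero
    have hur : (u ^ r).coeff (n * r) = 1 := by
      have := (hu.pow r).coeff_natDegree
      rwa [hu.natDegree_pow, hun, mul_comm] at this
    have hvr : (v ^ r).coeff (n * r) = 1 := by
      have := (hv.pow r).coeff_natDegree
      rwa [hv.natDegree_pow, hvn, mul_comm] at this
    rw [coeff_add, hur, hvr]
    intro h; exact h2 (by linear_combination h)
  have hEne : (u ^ r + v ^ r) ≠ 0 := by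
    intro h
    rw [h] at hEdeg
    simp at hEdeg
    omega
  have hh'0 : h' ≠ 0 := by
    intro h
    rw [h, mul_zero] at hzw
    exact mul_ne_zero hh0 (pow_ne_zero _ (mul_ne_zero (mul_ne_zero hu.ne_zero hv.ne_zero)
      (pow_ne_zero _ hEne))) hzw
  have hlow := natDegree_le_of_dvd hdvd hh'0
  rw [natDegree_pow, natDegree_pow] at hlow
  have hup : h'.natDegree + 1 + q ≤ (A + n * n - 2 * n) + q * (2 * n + n * n - 2 * n) := by
    have hB : w.2.eval (X ^ q) * S = 0 ∨ (w.2.eval (X ^ q) * S).natDegree + 1 + q ≤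
        (A + n * n - 2 * n) + q * (2 * n + n * n - 2 * n) := by
      rcases VV_eval_natDegree (q := q) hw.2 with h | h
      · left; rw [h]; simp
      · right
        have hSd : S.natDegree ≤ n * (q + 1) := by
          rw [hSdef]
          refine natDegree_mul_le.trans ?_
          have : (2 : F[X]).natDegree = 0 := natDegree_ofNat 2
          rw [this, (hu.mul hv).natDegree_pow, hu.natDegree_mul hv, hun, hvn, hr]
          nlinarith
        have h5 := natDegree_mul_le (p := w.2.eval (X ^ q)) (q := S)
        obtain ⟨x, hx⟩ : ∃ x, A + n * n - 2 * n = x + n :=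
          ⟨A + n * n - 2 * n - n, by
            have : 3 * n ≤ A + n * n := by
              rw [hA]; have : n * n = n ^ 2 := by ring
              zify [show n ≤ 2 * n ^ 2 by omega]; nlinarith
            omega⟩
        obtain ⟨y, hy⟩ : ∃ y, 2 * n + n * n - 2 * n = y + n :=
          ⟨n * n - n, by have : n ≤ n * n := by nlinarith
                         omega⟩
        rw [hx, hy, Nat.add_sub_cancel, Nat.add_sub_cancel] at h
        rw [hx, hy]
        nlinarith
    have hPd : w.1.eval (X ^ q) = 0 ∨ (w.1.eval (X ^ q)).natDegree + 1 + q ≤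
        (A + n * n - 2 * n) + q * (2 * n + n * n - 2 * n) := by
      rcases VV_eval_natDegree (q := q) hw.1 with h | h
      · left; rw [h]; simp
      · right; exact h
    have h6 := natDegree_add_le (w.1.eval (X ^ q)) (w.2.eval (X ^ q) * S)
    rw [← hh'] at h6
    rcases hPd with h7 | h7 <;> rcases hB with h8 | h8
    · exact absurd (show h' = 0 by rw [hh', h7, h8, add_zero]) hh'0
    · rw [hh', h7, zero_add]; exact h8
    · rw [hh', h8, add_zero]; exact h7
    · rcases le_max_iff.1 h6 with h9 | h9 <;> omega
  have h10 : n * (2 * (n * r)) ≤ h'.natDegree :=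
    le_trans (Nat.mul_le_mul_left _ (Nat.mul_le_mul_left _ hEdeg)) hlow
  rw [show 2 * n + n * n - 2 * n = n * n by omega] at hup
  have h11 : A + n * n - 2 * n + 3 * n = 3 * (n * n) + 1 := by
    rw [hA, pow_two]
    rw [pow_two] at hnn
    omega
  rw [hr] at hup hq
  nlinarith
end


/-- Let `g : ℕ` and let `F` be a finite field of odd cardinality
`q > 2g² + 2g + 3 + 2g⌈√(g² + 2g + 3)⌉`. If `a₁, …, a_{2g+2}` are pairwise distinct elements
of `F`, then there is `x ∈ F` such that `(x - a₁)⋯(x - a_{2g+2})` is not a square in `F`;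
in particular no `y ∈ F` satisfies `y² = (x - a₁)⋯(x - a_{2g+2})`. -/
theorem stmt_10 (g : ℕ) (F : Type*) [Field F] [Fintype F]
    (hodd : Odd (Fintype.card F))
    (hq : Fintype.card F >
      2 * g ^ 2 + 2 * g + 3 + 2 * g * ⌈Real.sqrt ((g : ℝ) ^ 2 + 2 * g + 3)⌉₊)
    (a : Fin (2 * g + 2) → F) (ha : Function.Injective a) :
    ∃ x : F, ¬ IsSquare (∏ j : Fin (2 * g + 2), (x - a j)) ∧
      ∀ y : F, y ^ 2 ≠ ∏ j : Fin (2 * g + 2), (x - a j) := by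
  suffices h : ∃ x : F, ¬ IsSquare (∏ j : Fin (2 * g + 2), (x - a j)) by
    obtain ⟨x, hx⟩ := h
    refine ⟨x, hx, fun y hy => hx ⟨y, ?_⟩⟩
    rw [← hy, pow_two]
  by_contra! hall
  have e : Fin (g + 1) ⊕ Fin (g + 1) ≃ Fin (2 * g + 2) :=
    Fintype.equivOfCardEq (by simp; ring)
  set b : Fin (g + 1) → F := fun i => a (e (Sum.inl i)) with hb
  set c : Fin (g + 1) → F := fun i => a (e (Sum.inr i)) with hc
  have hprod : ∀ (R : Type _) [CommRing R] (φ : F → R),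
      ∏ j, φ (a j) = (∏ i, φ (b i)) * ∏ i, φ (c i) := by
    intro R _ φ
    rw [← Equiv.prod_comp e, Fintype.prod_sum_type]
  obtain ⟨r, hr⟩ := hodd
  have hceil : g + 2 ≤ ⌈Real.sqrt ((g : ℝ) ^ 2 + 2 * g + 3)⌉₊ := by
    rw [Nat.succ_le_iff, Nat.lt_ceil]
    apply Real.lt_sqrt_of_sq_lt
    push_cast
    nlinarith
  have hq' : 2 * g ^ 2 + 2 * g + 3 + 2 * g * (g + 2) < Fintype.card F :=
    lt_of_le_of_lt (by gcongr) hq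
  have hdeg : ∀ w : Fin (g + 1) → F, (∏ i, (X - C (w i))).natDegree = g + 1 := by
    intro w
    rw [natDegree_prod_of_monic _ _ (fun i _ => monic_X_sub_C _)]
    simp
  refine core (n := g + 1) (by omega) hr (by nlinarith)
    (u := ∏ i, (X - C (b i))) (v := ∏ i, (X - C (c i)))
    (monic_prod_of_monic _ _ fun i _ => monic_X_sub_C _)
    (monic_prod_of_monic _ _ fun i _ => monic_X_sub_C _) (hdeg b) (hdeg c) ?_ (b 0) ?_ ?_ ?_
  · rintro x ⟨h1, h2⟩
    simp only [eval_prod, eval_sub, eval_X, eval_C, Finset.prod_eq_zero_iff, Finset.mem_univ,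
      true_and, sub_eq_zero] at h1 h2
    obtain ⟨i, hi⟩ := h1
    obtain ⟨j, hj⟩ := h2
    have := e.injective (ha (hi.symm.trans hj))
    simp at this
  · rw [eval_prod]
    exact Finset.prod_eq_zero (Finset.mem_univ 0) (by simp)
  · classical
    rw [← hprod F[X] (fun y => X - C y), ← count_roots]
    have h1 : ∏ j, (X - C (a j)) = (Multiset.map (fun y => X - C y)
        (Finset.univ.val.map a)).prod := by
      rw [Multiset.map_map]; rfl
    rw [h1, roots_multiset_prod_X_sub_C]
    refine Multiset.count_eq_one_of_mem (Finset.univ.nodup.map ha) ?_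
    exact Multiset.mem_map_of_mem a (by simp)
  · intro x
    have := hall x
    rw [hprod F (fun y => x - y)] at this
    simpa [eval_prod] using this
end
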